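/- arXiv:1006.5515 — 7 statements merged into one kernel-verified Lean document; each statement's English description precedes it below -/
import Mathlib

section
/- String equation: if V is continuously differentiable on [−1,1], then for every integer k ≥ 1, ∫_{−π}^{π} sin λ · V′(cos λ) · χ_k^{(n)}(λ) · conj(χ_{k−1}^{(n)}(λ)) · e^{−nV(cos λ)} dλ = i·(−1)^{k−1}·(k/n)·α_k^{(n)}/ρ_k^{(n)}. -/
open Real MeasureTheory Complex ComplexConjugate

/-- The defining relations of orthonormal polynomials paired with the exponentials:
`⟨P_k, e^{ijλ}⟩` vanishes for `j < k` and equals `1 / c_{k,k}` for `j = k`. -/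
lemma orthonormal_moment (w : ℝ → ℂ) (hw : Continuous w) (c : ℕ → ℕ → ℂ)
    (hc : ∀ k, (c k k).im = 0 ∧ 0 < (c k k).re) (P : ℕ → ℝ → ℂ)
    (hP : ∀ k (l : ℝ), P k l =
      ∑ j ∈ Finset.range (k + 1), c k j * Complex.exp (Complex.I * j * l))
    (horth : ∀ j k : ℕ,
      (∫ l in (-π)..π, P j l * conj (P k l) * w l) = if j = k then 1 else 0)
    (k j : ℕ) (hj : j ≤ k) :
    (∫ l in (-π)..π, P k l * conj (Complex.exp (Complex.I * j * l)) * w l)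
      = if j = k then 1 / c k k else 0 := by
  have hPc : ∀ k, Continuous (P k) := fun k => by
    rw [show P k = _ from funext (hP k)]
    fun_prop
  have hPk := hPc k
  induction j using Nat.strong_induction_on with
  | _ j ih =>
    have hcj : c j j ≠ 0 := fun h => by simpa [h] using (hc j).2
    have hconj : conj (c j j) = c j j := Complex.conj_eq_iff_im.2 (hc j).1
    have h := horth k j
    have hint : (∫ l in (-π)..π, P k l * conj (P j l) * w l) =
        ∑ i ∈ Finset.range (j + 1), conj (c j i) *
          ∫ l in (-π)..π, P k l * conj (Complex.exp (Complex.I * i * l)) * w l := by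
      simp_rw [← intervalIntegral.integral_const_mul]
      rw [← intervalIntegral.integral_finsetSum]
      · refine intervalIntegral.integral_congr fun l _ => ?_
        simp only [hP j l, map_sum, map_mul, Finset.mul_sum, Finset.sum_mul]
        exact Finset.sum_congr rfl fun i _ => by ring
      · intro i _
        apply Continuous.intervalIntegrable
        fun_prop
    rw [hint, Finset.sum_range_succ, Finset.sum_eq_zero, zero_add, hconj] at h
    · rw [← mul_right_inj' hcj, h]
      by_cases hjk : j = k
      · subst hjk
        simp [hcj]
      · simp [hjk, Ne.symm hjk]
    · intro i hi
      have hij := Finset.mem_range.1 hi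
      rw [ih i hij (by omega), if_neg (by omega), mul_zero]

/-- For an even weight, `⟨e^{ijλ}, Q_m⟩` vanishes for `1 ≤ j ≤ m` and equals `1 / c_{m,m}` for
`j = 0`, where `Q_m(λ) = e^{imλ} P_m(-λ)`. -/
lemma reverse_moment (w : ℝ → ℂ) (hw : Continuous w) (hwe : ∀ l, w (-l) = w l)
    (hwr : ∀ l, conj (w l) = w l) (c : ℕ → ℕ → ℂ)
    (hc : ∀ k, (c k k).im = 0 ∧ 0 < (c k k).re) (P : ℕ → ℝ → ℂ)
    (hP : ∀ k (l : ℝ), P k l =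
      ∑ j ∈ Finset.range (k + 1), c k j * Complex.exp (Complex.I * j * l))
    (horth : ∀ j k : ℕ,
      (∫ l in (-π)..π, P j l * conj (P k l) * w l) = if j = k then 1 else 0)
    (m j : ℕ) (hj : j ≤ m) :
    (∫ l in (-π)..π, Complex.exp (Complex.I * j * l) *
        conj (Complex.exp (Complex.I * m * l) * P m (-l)) * w l)
      = if j = 0 then 1 / c m m else 0 := by
  have hconj : conj (c m m) = c m m := Complex.conj_eq_iff_im.2 (hc m).1
  have h := congrArg conj
    (orthonormal_moment w hw c hc P hP horth m (m - j) (Nat.sub_le _ _))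
  rw [← intervalIntegral.intervalIntegral_conj] at h
  have hneg := intervalIntegral.integral_comp_neg (a := -π) (b := π) (fun l : ℝ =>
    Complex.exp (Complex.I * j * l) *
      conj (Complex.exp (Complex.I * m * l) * P m (-l)) * w l)
  rw [neg_neg] at hneg
  rw [← hneg]
  trans conj (if m - j = m then 1 / c m m else 0)
  · rw [← h]
    refine intervalIntegral.integral_congr fun l _ => ?_
    have hexp : Complex.exp (Complex.I * j * (-l : ℝ)) *
        conj (Complex.exp (Complex.I * m * (-l : ℝ))) =
        Complex.exp (Complex.I * (m - j : ℕ) * l) := by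
      rw [← Complex.exp_conj, ← Complex.exp_add]
      congr 1
      push_cast [Nat.cast_sub hj]
      simp
      ring
    simp only [map_mul, neg_neg, hwe, hwr, Complex.conj_conj]
    rw [← hexp]
    ring
  · by_cases h0 : j = 0
    · simp [h0, hconj]
    · rw [if_neg h0, if_neg (by omega), map_zero]

/-- Integration by parts of `P_{m+1} conj(Q_m)` against the derivative of a periodic even
weight. -/
lemma integral_deriv_weight_mul (w w' : ℝ → ℂ) (hw : ∀ l, HasDerivAt w (w' l) l)
    (hw' : Continuous w') (hwe : ∀ l, w (-l) = w l)
    (hwr : ∀ l, conj (w l) = w l) (c : ℕ → ℕ → ℂ)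
    (hc : ∀ k, (c k k).im = 0 ∧ 0 < (c k k).re) (P : ℕ → ℝ → ℂ)
    (hP : ∀ k (l : ℝ), P k l =
      ∑ j ∈ Finset.range (k + 1), c k j * Complex.exp (Complex.I * j * l))
    (horth : ∀ j k : ℕ,
      (∫ l in (-π)..π, P j l * conj (P k l) * w l) = if j = k then 1 else 0)
    (m : ℕ) :
    (∫ l in (-π)..π, P (m + 1) l *
        conj (Complex.exp (Complex.I * m * l) * P m (-l)) * w' l)
      = Complex.I * (m + 1 : ℕ) * (c (m + 1) 0 / c m m) := by
  have hwc : Continuous w := continuous_iff_continuousAt.2 fun l => (hw l).continuousAt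
  have hPc : ∀ k, Continuous (P k) := fun k => by
    rw [show P k = _ from funext (hP k)]
    fun_prop
  have hPk := hPc (m + 1)
  have hPm := hPc m
  have hexp : ∀ (a : ℂ) (l : ℝ), HasDerivAt (fun l : ℝ => Complex.exp (a * l))
      (a * Complex.exp (a * l)) l := fun a l => by
    have h := ((hasDerivAt_id (l : ℂ)).const_mul a).cexp.comp_ofReal
    simpa [mul_comm] using h
  set R : ℝ → ℂ := fun l => conj (Complex.exp (Complex.I * m * l) * P m (-l)) with hR
  have hRc : Continuous R := by fun_prop
  have hRsum : ∀ l, R l = ∑ j ∈ Finset.range (m + 1),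
      conj (c m (m - j)) * conj (Complex.exp (Complex.I * j * l)) := by
    intro l
    rw [← Finset.sum_range_reflect]
    simp only [hR, hP m, map_mul, map_sum, Finset.mul_sum]
    refine Finset.sum_congr rfl fun j hj => ?_
    have hjm : j ≤ m := by simpa [Nat.lt_succ_iff] using hj
    rw [show m + 1 - 1 - j = m - j by omega, Nat.sub_sub_self hjm, mul_left_comm,
      ← map_mul, ← Complex.exp_add]
    congr 3
    push_cast [Nat.cast_sub hjm]
    ring
  have hRsum' : ∀ l : ℝ, R l = ∑ j ∈ Finset.range (m + 1),
      conj (c m (m - j)) * Complex.exp (-(Complex.I * j) * l) := by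
    intro l
    rw [hRsum]
    refine Finset.sum_congr rfl fun j _ => ?_
    rw [← Complex.exp_conj]
    simp
  set P' : ℝ → ℂ := fun l => ∑ j ∈ Finset.range (m + 1 + 1),
    c (m + 1) j * (Complex.I * j * Complex.exp (Complex.I * j * l)) with hP'
  set R' : ℝ → ℂ := fun l => ∑ j ∈ Finset.range (m + 1),
    conj (c m (m - j)) * (-(Complex.I * j) * Complex.exp (-(Complex.I * j) * l)) with hR'
  have hP'c : Continuous P' := by fun_prop
  have hR'c : Continuous R' := by fun_prop
  have hPd : ∀ l, HasDerivAt (P (m + 1)) (P' l) l := fun l => by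
    rw [show P (m + 1) = _ from funext (hP (m + 1))]
    exact HasDerivAt.fun_sum fun j _ => (hexp _ l).const_mul _
  have hRd : ∀ l, HasDerivAt R (R' l) l := fun l => by
    rw [show R = _ from funext hRsum']
    exact HasDerivAt.fun_sum fun j _ => (hexp _ l).const_mul _
  have horthR : ∀ b : ℕ → ℂ, (∫ l in (-π)..π, P (m + 1) l *
      (∑ j ∈ Finset.range (m + 1), b j * conj (Complex.exp (Complex.I * j * l))) * w l)
      = 0 := by
    intro b
    trans ∑ j ∈ Finset.range (m + 1), b j *
      ∫ l in (-π)..π, P (m + 1) l * conj (Complex.exp (Complex.I * j * l)) * w l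
    · simp_rw [← intervalIntegral.integral_const_mul]
      rw [← intervalIntegral.integral_finsetSum]
      · refine intervalIntegral.integral_congr fun l _ => ?_
        simp only [Finset.mul_sum, Finset.sum_mul]
        exact Finset.sum_congr rfl fun i _ => by ring
      · intro i _
        apply Continuous.intervalIntegrable
        fun_prop
    · refine Finset.sum_eq_zero fun j hj => ?_
      have := Finset.mem_range.1 hj
      rw [orthonormal_moment w hwc c hc P hP horth _ _ (by omega), if_neg (by omega),
        mul_zero]
  have hPR : (∫ l in (-π)..π, P (m + 1) l * R l * w l) = 0 := by
    simp_rw [hRsum]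
    exact horthR _
  have hPR' : (∫ l in (-π)..π, P (m + 1) l * R' l * w l) = 0 := by
    rw [← horthR fun j => conj (c m (m - j)) * (-(Complex.I * j))]
    refine intervalIntegral.integral_congr fun l _ => ?_
    simp only [hR']
    congr 2
    refine Finset.sum_congr rfl fun j _ => ?_
    rw [← Complex.exp_conj]
    simp [mul_assoc]
  have hP'R : (∫ l in (-π)..π, P' l * R l * w l)
      = -(Complex.I * (m + 1 : ℕ) * (c (m + 1) 0 / c m m)) := by
    have hsplit : ∀ l, P' l * R l * w l = Complex.I * (m + 1 : ℕ) * (P (m + 1) l * R l * w l) +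
        ∑ j ∈ Finset.range (m + 1), (Complex.I * (j - (m + 1 : ℕ)) * c (m + 1) j) *
          (Complex.exp (Complex.I * j * l) * R l * w l) := by
      intro l
      simp only [hP', hP (m + 1) l]
      rw [Finset.sum_range_succ _ (m + 1), Finset.sum_range_succ _ (m + 1)]
      simp only [add_mul, mul_add, Finset.sum_mul, Finset.mul_sum]
      rw [add_right_comm, ← Finset.sum_add_distrib]
      congr 1
      · refine Finset.sum_congr rfl fun j _ => ?_
        ring
      · ring
    simp_rw [hsplit]
    rw [intervalIntegral.integral_add, intervalIntegral.integral_const_mul, hPR,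
      intervalIntegral.integral_finsetSum]
    · simp_rw [intervalIntegral.integral_const_mul]
      rw [Finset.sum_eq_single 0]
      · rw [reverse_moment w hwc hwe hwr c hc P hP horth m 0 (Nat.zero_le _)]
        simp
        ring
      · intro j hj hj0
        have := Finset.mem_range.1 hj
        rw [reverse_moment w hwc hwe hwr c hc P hP horth m j (by omega), if_neg hj0, mul_zero]
      · simp
    · intro i _
      apply Continuous.intervalIntegrable
      fun_prop
    · apply Continuous.intervalIntegrable
      fun_prop
    · apply Continuous.intervalIntegrable
      fun_prop
  have hper : P (m + 1) π * R π = P (m + 1) (-π) * R (-π) := by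
    have he : ∀ j : ℕ, Complex.exp (Complex.I * j * (π : ℝ)) =
        Complex.exp (Complex.I * j * (-π : ℝ)) := fun j => by
      rw [Complex.exp_eq_exp_iff_exists_int]
      exact ⟨j, by push_cast; ring⟩
    have h1 : P (m + 1) π = P (m + 1) (-π) := by
      simp only [hP, he]
    have h2 : R π = R (-π) := by
      simp only [hRsum, he]
    rw [h1, h2]
  have hibp := intervalIntegral.integral_mul_deriv_eq_deriv_mul (a := -π) (b := π)
    (u := fun l => P (m + 1) l * R l) (v := w) (u' := fun l => P' l * R l + P (m + 1) l * R' l)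
    (v' := w') (fun l _ => (hPd l).mul (hRd l)) (fun l _ => hw l)
    (by apply Continuous.intervalIntegrable; fun_prop)
    (by apply Continuous.intervalIntegrable; fun_prop)
  beta_reduce at hibp
  rw [hibp, hper, hwe π, sub_self, zero_sub]
  simp_rw [add_mul]
  rw [intervalIntegral.integral_add, hP'R, hPR', add_zero, neg_neg]
  · apply Continuous.intervalIntegrable
    fun_prop
  · apply Continuous.intervalIntegrable
    fun_prop

/-- The product of consecutive CMV basis functions is `P_{m+1} conj(Q_m)`, up to a reflection of
the argument. -/
lemma cmv_mul_conj (P χ : ℕ → ℝ → ℂ)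
    (hχ : ∀ k (l : ℝ), χ k l =
      Complex.exp (-Complex.I * (k / 2 : ℕ) * l) *
        (if Even k then Complex.exp (Complex.I * k * l) * P k (-l) else P k l))
    (m : ℕ) (l : ℝ) :
    χ (m + 1) l * conj (χ m l) =
      if Even m then P (m + 1) l * conj (Complex.exp (Complex.I * m * l) * P m (-l))
      else P (m + 1) (-l) * conj (Complex.exp (Complex.I * m * (-l : ℝ)) * P m l) := by
  have hconj : ∀ x : ℝ, ∀ a : ℕ, conj (Complex.exp (Complex.I * a * x)) =
      Complex.exp (-Complex.I * a * x) := fun x a => by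
    rw [← Complex.exp_conj]; simp
  have hconj' : ∀ x : ℝ, ∀ a : ℕ, conj (Complex.exp (-Complex.I * a * x)) =
      Complex.exp (Complex.I * a * x) := fun x a => by
    rw [← hconj, Complex.conj_conj]
  rw [hχ, hχ]
  rcases Nat.even_or_odd m with hm | hm
  · have h1 : ¬ Even (m + 1) := by simpa [Nat.even_add_one] using hm
    obtain ⟨r, rfl⟩ := hm
    rw [if_neg h1, if_pos ⟨r, rfl⟩, if_pos ⟨r, rfl⟩,
      show (r + r + 1) / 2 = r by omega, show (r + r) / 2 = r by omega]
    simp only [map_mul, hconj, hconj']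
    have : Complex.exp (-Complex.I * r * l) * Complex.exp (Complex.I * r * l) = 1 := by
      rw [← Complex.exp_add]; simp
    linear_combination (P (r + r + 1) l * Complex.exp (-Complex.I * (r + r : ℕ) * l) *
      conj (P (r + r) (-l))) * this
  · have h0 : ¬ Even m := Nat.not_even_iff_odd.2 hm
    have h1 : Even (m + 1) := hm.add_one
    obtain ⟨r, rfl⟩ := hm
    rw [if_pos h1, if_neg h0, if_neg h0,
      show (2 * r + 1 + 1) / 2 = r + 1 by omega, show (2 * r + 1) / 2 = r by omega]
    simp only [map_mul, hconj, hconj']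
    have : Complex.exp (-Complex.I * (r + 1 : ℕ) * l) *
        Complex.exp (Complex.I * (2 * r + 1 + 1 : ℕ) * l) * Complex.exp (Complex.I * r * l) =
        Complex.exp (-Complex.I * (2 * r + 1 : ℕ) * (-l : ℝ)) := by
      rw [← Complex.exp_add, ← Complex.exp_add]
      congr 1
      push_cast
      ring
    rw [← this]
    ring

/-- The derivative of the weight `e^{-nV(cos λ)}`. The two-sided derivative of `V` at `±1` is
irrelevant because `sin` vanishes there. -/
lemma hasDerivAt_weight (n : ℕ) (V : ℝ → ℝ) (hV : ContDiffOn ℝ 1 V (Set.Icc (-1 : ℝ) 1)) :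
    (∀ l, HasDerivAt (fun l : ℝ => ((Real.exp (-(n : ℝ) * V (Real.cos l)) : ℝ) : ℂ))
      (n * ((Real.sin l : ℂ) * (deriv V (Real.cos l) : ℝ) *
        (Real.exp (-(n : ℝ) * V (Real.cos l)) : ℝ))) l) ∧
    Continuous fun l : ℝ => (n * ((Real.sin l : ℂ) * (deriv V (Real.cos l) : ℝ) *
        (Real.exp (-(n : ℝ) * V (Real.cos l)) : ℝ)) : ℂ) := by
  have hcos : ∀ l, Real.cos l ∈ Set.Icc (-1 : ℝ) 1 := Real.cos_mem_Icc
  have hu : UniqueDiffOn ℝ (Set.Icc (-1 : ℝ) 1) := uniqueDiffOn_Icc (by norm_num)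
  have hderiv : ∀ l, Real.sin l * deriv V (Real.cos l) =
      Real.sin l * derivWithin V (Set.Icc (-1) 1) (Real.cos l) := by
    intro l
    by_cases hs : Real.sin l = 0
    · simp [hs]
    · rw [derivWithin_of_mem_nhds]
      have := Real.sin_sq_add_cos_sq l
      have hpos : 0 < Real.sin l ^ 2 := by positivity
      exact Icc_mem_nhds (by nlinarith [(hcos l).1, (hcos l).2])
        (by nlinarith [(hcos l).1, (hcos l).2])
  have hVc : Continuous fun l => V (Real.cos l) :=
    hV.continuousOn.comp_continuous Real.continuous_cos hcos
  have hV'c : Continuous fun l => derivWithin V (Set.Icc (-1) 1) (Real.cos l) :=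
    (hV.continuousOn_derivWithin hu le_rfl).comp_continuous Real.continuous_cos hcos
  constructor
  · intro l
    have h1 : HasDerivAt (fun l => V (Real.cos l))
        (derivWithin V (Set.Icc (-1) 1) (Real.cos l) * -Real.sin l) l :=
      ((hV.differentiableOn one_ne_zero _ (hcos l)).hasDerivWithinAt).comp_hasDerivAt l
        (Real.hasDerivAt_cos l) (Filter.Eventually.of_forall hcos)
    convert ((h1.const_mul (-(n : ℝ))).exp).ofReal_comp using 1
    rw [← Complex.ofReal_mul, hderiv]
    push_cast
    ring
  · simp_rw [← Complex.ofReal_mul, hderiv]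
    exact continuous_const.mul (Complex.continuous_ofReal.comp
      ((Real.continuous_sin.mul hV'c).mul (Real.continuous_exp.comp (continuous_const.mul hVc))))

/-- String equation for the CMV basis functions: if `V` is continuously differentiable
on `[−1,1]`, then for every `k ≥ 1`,
`∫_{−π}^{π} sin λ·V′(cos λ)·χ_k(λ)·conj(χ_{k−1}(λ))·e^{−nV(cos λ)} dλ
  = i·(−1)^{k−1}·(k/n)·α_k/ρ_k`.
Here `P_k(λ) = Σ_{l ≤ k} c_{k,l} e^{ilλ}` (with `c_{k,k} > 0` real) are the
orthonormal polynomials for the weight `e^{−nV(cos λ)}`,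
`Q_k(λ) = e^{ikλ}·P_k(−λ)`, `χ_{2j} = e^{−ijλ}·Q_{2j}`, `χ_{2j+1} = e^{−ijλ}·P_{2j+1}`,
`α_k = c_{k,0}/c_{k,k}` and `ρ_k = c_{k−1,k−1}/c_{k,k}`. -/
theorem stmt_3 (n : ℕ) (hn : 1 ≤ n) (V : ℝ → ℝ)
    (hV : ContDiffOn ℝ 1 V (Set.Icc (-1 : ℝ) 1))
    (c : ℕ → ℕ → ℂ)
    (hc : ∀ k, (c k k).im = 0 ∧ 0 < (c k k).re)
    (P : ℕ → ℝ → ℂ)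
    (hP : ∀ k (l : ℝ), P k l =
      ∑ j ∈ Finset.range (k + 1), c k j * Complex.exp (Complex.I * j * l))
    (horth : ∀ j k : ℕ,
      (∫ l in (-π)..π, P j l * conj (P k l) * (Real.exp (-(n : ℝ) * V (Real.cos l)) : ℝ))
        = if j = k then 1 else 0)
    (χ : ℕ → ℝ → ℂ)
    (hχ : ∀ k (l : ℝ), χ k l =
      Complex.exp (-Complex.I * (k / 2 : ℕ) * l) *
        (if Even k then Complex.exp (Complex.I * k * l) * P k (-l) else P k l))
    (k : ℕ) (hk : 1 ≤ k) :
    (∫ l in (-π)..π, (Real.sin l : ℂ) * (deriv V (Real.cos l) : ℝ) * χ k l *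
        conj (χ (k - 1) l) * (Real.exp (-(n : ℝ) * V (Real.cos l)) : ℝ))
      = Complex.I * (-1) ^ (k - 1) * ((k : ℂ) / n) *
          (c k 0 / c k k) / (c (k - 1) (k - 1) / c k k) := by
  obtain ⟨m, rfl⟩ : ∃ m, k = m + 1 := ⟨k - 1, by omega⟩
  obtain ⟨hw, hw'⟩ := hasDerivAt_weight n V hV
  have hn0 : (n : ℂ) ≠ 0 := by exact_mod_cast (by omega : n ≠ 0)
  have hck : c (m + 1) (m + 1) ≠ 0 := fun h => by simpa [h] using (hc (m + 1)).2
  have hcm : c m m ≠ 0 := fun h => by simpa [h] using (hc m).2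
  have key := integral_deriv_weight_mul _ _ hw hw' (fun l => by simp)
    (fun l => Complex.conj_ofReal _) c hc P hP horth m
  set g : ℝ → ℂ := fun l => P (m + 1) l *
    conj (Complex.exp (Complex.I * m * l) * P m (-l)) with hg
  set v : ℝ → ℂ := fun l => (Real.sin l : ℂ) * (deriv V (Real.cos l) : ℝ) *
    (Real.exp (-(n : ℝ) * V (Real.cos l)) : ℝ) with hv
  have hgv : n * (∫ l in (-π)..π, g l * v l) =
      Complex.I * (m + 1 : ℕ) * (c (m + 1) 0 / c m m) := by
    rw [← key, ← intervalIntegral.integral_const_mul]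
    exact intervalIntegral.integral_congr fun l _ => by simp only [hg, hv]; ring
  have hsign : (∫ l in (-π)..π, (Real.sin l : ℂ) * (deriv V (Real.cos l) : ℝ) * χ (m + 1) l *
      conj (χ m l) * (Real.exp (-(n : ℝ) * V (Real.cos l)) : ℝ)) =
      (-1) ^ m * ∫ l in (-π)..π, g l * v l := by
    have hprod := cmv_mul_conj P χ hχ m
    rcases Nat.even_or_odd m with hm | hm
    · rw [hm.neg_one_pow, one_mul]
      refine intervalIntegral.integral_congr fun l _ => ?_
      have h := hprod l
      rw [if_pos hm] at h
      simp only [hg, hv]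
      rw [← h]
      ring
    · have hneg := intervalIntegral.integral_comp_neg (a := -π) (b := π) fun l => g l * v l
      rw [neg_neg] at hneg
      rw [hm.neg_one_pow, ← hneg, ← intervalIntegral.integral_const_mul]
      refine intervalIntegral.integral_congr fun l _ => ?_
      have h := hprod l
      rw [if_neg (Nat.not_even_iff_odd.2 hm)] at h
      simp only [hg, hv, neg_neg, Real.sin_neg, Real.cos_neg]
      rw [← h]
      push_cast
      ring
  rw [Nat.add_sub_cancel, hsign, ← mul_right_inj' hn0, mul_left_comm, hgv]
  field_simp
end

section
/- For every integer l ≥ 1 and every u ∈ ℝ, ∫_{−π}^{π} D_l(cos u, cos v) dv = 2π·U_{l−1}(cos u), where D_l is the two-variable polynomial determined by D_l(x,y)·(x − y) = T_l(x) − T_l(y) (the divided difference of the Chebyshev polynomial T_l) and U_{l−1} is the Chebyshev polynomial of the second kind; equivalently, ∫_{−π}^{π} (cos(lu) − cos(lv))/(cos u − cos v) dv = 2π·sin(lu)/sin(u) with the integrand understood via its continuous extension. -/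
open Real Polynomial

namespace Polynomial

theorem X_sub_C_mul_divByMonic_X_sub_C {R : Type*} [CommRing R] (p : R[X]) (x : R) :
    (X - C x) * (p /ₘ (X - C x)) = p - C (p.eval x) := by
  rw [X_sub_C_mul_divByMonic_eq_sub_modByMonic, modByMonic_X_sub_C_eq_C_eval]

theorem eq_divByMonic_X_sub_C_of_mul_eq {R : Type*} [CommRing R] {p q : R[X]} {x : R}
    (h : (X - C x) * q = p - C (p.eval x)) : p /ₘ (X - C x) = q := by
  apply (monic_X_sub_C x).isRegular.left
  simp only [h, X_sub_C_mul_divByMonic_X_sub_C]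

namespace Chebyshev

theorem T_add_two_divByMonic_X_sub_C {R : Type*} [CommRing R] (x : R) (n : ℤ) :
    T R (n + 2) /ₘ (X - Polynomial.C x) =
      Polynomial.C (2 * x) * (T R (n + 1) /ₘ (X - Polynomial.C x)) + 2 * T R (n + 1) - T R n /ₘ (X - Polynomial.C x) := by
  apply eq_divByMonic_X_sub_C_of_mul_eq
  have h₀ := X_sub_C_mul_divByMonic_X_sub_C (T R n) x
  have h₁ := X_sub_C_mul_divByMonic_X_sub_C (T R (n + 1)) x
  simp only [T_add_two, eval_sub, eval_mul, eval_ofNat, eval_X, Polynomial.C_sub, Polynomial.C_mul, Polynomial.C_ofNat]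
  linear_combination 2 * Polynomial.C x * h₁ - h₀

theorem integral_T_cos_eq_zero {n : ℤ} (hn : n ≠ 0) :
    ∫ v in (-π)..π, (T ℝ n).eval (Real.cos v) = 0 := by
  have hn' : (n : ℝ) ≠ 0 := by exact_mod_cast hn
  simp only [T_real_cos]
  rw [intervalIntegral.integral_comp_mul_left (fun v => Real.cos v) hn', integral_cos]
  simp [Real.sin_int_mul_pi]

theorem integral_T_divByMonic_cos (x : ℝ) (n : ℕ) :
    ∫ v in (-π)..π, (T ℝ n /ₘ (X - Polynomial.C x)).eval (Real.cos v) = 2 * π * (U ℝ (n - 1)).eval x := by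
  induction n using Nat.twoStepInduction with
  | zero =>
    have h : (1 : ℝ[X]) /ₘ (X - Polynomial.C x) = 0 := eq_divByMonic_X_sub_C_of_mul_eq (by simp)
    simp [h]
  | one =>
    have h : (X : ℝ[X]) /ₘ (X - Polynomial.C x) = 1 := eq_divByMonic_X_sub_C_of_mul_eq (by simp)
    simp [h]
    ring
  | more n ih₀ ih₁ =>
    have hint (p : ℝ[X]) :
        IntervalIntegrable (fun v => p.eval (Real.cos v)) MeasureTheory.volume (-π) π :=
      (p.continuous.comp Real.continuous_cos).intervalIntegrable _ _
    have hU := congrArg (eval x) (U_add_two ℝ ((n : ℤ) - 1))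
    rw [show (n : ℤ) - 1 + 2 = n + 2 - 1 by ring, show (n : ℤ) - 1 + 1 = n + 1 - 1 by ring] at hU
    simp only [eval_sub, eval_mul, eval_ofNat, eval_X] at hU
    push_cast at ih₁ ⊢
    simp only [T_add_two_divByMonic_X_sub_C, eval_sub, eval_add, eval_mul, eval_C, eval_ofNat]
    rw [intervalIntegral.integral_sub (((hint _).const_mul _).add ((hint _).const_mul _)) (hint _),
      intervalIntegral.integral_add ((hint _).const_mul _) ((hint _).const_mul _),
      intervalIntegral.integral_const_mul, intervalIntegral.integral_const_mul,
      integral_T_cos_eq_zero (by lia), ih₀, ih₁, hU]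
    ring

end Chebyshev

end Polynomial

/-- For every integer `l ≥ 1` and every `u ∈ ℝ`,
`∫_{−π}^{π} D_l(cos u, cos v) dv = 2π·U_{l−1}(cos u)`, where `D_l` is the two-variable
continuous function determined by `D_l(x,y)·(x − y) = T_l(x) − T_l(y)` and `U_{l−1}`
is the Chebyshev polynomial of the second kind. -/
theorem stmt_11 (l : ℤ) (hl : 1 ≤ l) (D : ℝ → ℝ → ℝ)
    (hDcont : Continuous fun p : ℝ × ℝ => D p.1 p.2)
    (hD : ∀ x y : ℝ, D x y * (x - y) =
      (Polynomial.Chebyshev.T ℝ l).eval x - (Polynomial.Chebyshev.T ℝ l).eval y)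
    (u : ℝ) :
    ∫ v in (-π)..π, D (Real.cos u) (Real.cos v)
      = 2 * π * (Polynomial.Chebyshev.U ℝ (l - 1)).eval (Real.cos u) := by
  lift l to ℕ using by lia
  generalize Real.cos u = x
  have hDq : D x = fun y => (Chebyshev.T ℝ l /ₘ (X - C x)).eval y := by
    refine Continuous.ext_on (dense_compl_singleton x)
      (hDcont.comp (Continuous.prodMk_right x)) (Polynomial.continuous _) fun y hy => ?_
    have hq := congrArg (eval y) (X_sub_C_mul_divByMonic_X_sub_C (Chebyshev.T ℝ l) x)
    simp only [eval_mul, eval_sub, eval_X, eval_C] at hq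
    apply mul_right_cancel₀ (sub_ne_zero.mpr (Ne.symm hy))
    linear_combination hD x y + hq
  simp only [hDq]
  exact Chebyshev.integral_T_divByMonic_cos x l
end

section
/- For all integers k ≥ 0 and 0 ≤ α ≤ β, (1/(4π²))·∫_{−π}^{π}∫_{−π}^{π} D_k(cos u, cos v)·cos(αu)·cos(βv) du dv = 1 if k − α − β is a positive odd integer, and = 0 otherwise, where D_k is the two-variable polynomial determined by D_k(x,y)·(x − y) = T_k(x) − T_k(y); equivalently, the double integral of (cos(ku) − cos(kv))/(cos u − cos v)·cos(αu)·cos(βv), with the integrand understood via its continuous extension, equals 4π² exactly when k − α − β ∈ {1, 3, 5, …}. -/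
open Real Polynomial

/-- The divided difference `(T_k(x) - T_k(y)) / (x - y)` of the Chebyshev polynomial `T_k`,
defined through the three-term recurrence. -/
noncomputable def chebyshevDividedDifference : ℕ → ℝ → ℝ → ℝ
  | 0, _, _ => 0
  | 1, _, _ => 1
  | k + 2, x, y => 2 * x * chebyshevDividedDifference (k + 1) x y
      + 2 * (Polynomial.Chebyshev.T ℝ ((k : ℤ) + 1)).eval y - chebyshevDividedDifference k x y

theorem chebyshevDividedDifference_mul_sub (k : ℕ) (x y : ℝ) :
    chebyshevDividedDifference k x y * (x - y) =
      (Polynomial.Chebyshev.T ℝ (k : ℤ)).eval x - (Polynomial.Chebyshev.T ℝ (k : ℤ)).eval y := by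
  induction k using Nat.twoStepInduction with
  | zero => simp [chebyshevDividedDifference]
  | one => simp [chebyshevDividedDifference]
  | more k ih₀ ih₁ =>
    push_cast at ih₁ ⊢
    simp only [chebyshevDividedDifference, Polynomial.Chebyshev.T_add_two, eval_sub, eval_mul,
      eval_ofNat, eval_X]
    linear_combination 2 * x * ih₁ - ih₀

theorem continuous_chebyshevDividedDifference (k : ℕ) :
    Continuous fun p : ℝ × ℝ => chebyshevDividedDifference k p.1 p.2 := by
  induction k using Nat.twoStepInduction with
  | zero => simpa only [chebyshevDividedDifference] using continuous_const
  | one => simpa only [chebyshevDividedDifference] using continuous_const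
  | more k ih₀ ih₁ =>
    simp only [chebyshevDividedDifference]
    fun_prop

theorem eq_chebyshevDividedDifference {k : ℕ} {D : ℝ → ℝ → ℝ}
    (hDcont : Continuous fun p : ℝ × ℝ => D p.1 p.2)
    (hD : ∀ x y : ℝ, D x y * (x - y) =
      (Polynomial.Chebyshev.T ℝ (k : ℤ)).eval x - (Polynomial.Chebyshev.T ℝ (k : ℤ)).eval y) :
    D = chebyshevDividedDifference k := by
  funext x
  have h₁ : Continuous (D x) := hDcont.comp (Continuous.prodMk_right x)
  have h₂ : Continuous (chebyshevDividedDifference k x) :=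
    (continuous_chebyshevDividedDifference k).comp (Continuous.prodMk_right x)
  refine h₁.ext_on (dense_compl_singleton x) h₂ fun y hy => ?_
  exact mul_right_cancel₀ (sub_ne_zero.2 (Ne.symm hy))
    ((hD x y).trans (chebyshevDividedDifference_mul_sub k x y).symm)

theorem integral_cos_int_mul (n : ℤ) :
    ∫ u in (-π)..π, Real.cos (n * u) = if n = 0 then 2 * π else 0 := by
  split_ifs with h
  · simp [h]; ring
  · have hn : (n : ℝ) ≠ 0 := by exact_mod_cast h
    rw [intervalIntegral.integral_comp_mul_left _ hn]
    simp [Real.sin_int_mul_pi]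

theorem integral_cos_int_mul_mul_cos_int_mul (m n : ℤ) :
    ∫ u in (-π)..π, Real.cos (m * u) * Real.cos (n * u) =
      (if m + n = 0 then π else 0) + (if m - n = 0 then π else 0) := by
  have h : ∀ u : ℝ, Real.cos (m * u) * Real.cos (n * u) =
      (Real.cos ((m + n : ℤ) * u) + Real.cos ((m - n : ℤ) * u)) / 2 := fun u => by
    push_cast
    rw [add_mul, sub_mul, Real.cos_add, Real.cos_sub]
    ring
  simp only [h]
  rw [intervalIntegral.integral_div, intervalIntegral.integral_add
    (Continuous.intervalIntegrable (by fun_prop) _ _)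
    (Continuous.intervalIntegrable (by fun_prop) _ _),
    integral_cos_int_mul, integral_cos_int_mul]
  split_ifs <;> ring

theorem integral_integral_add {f g : ℝ → ℝ → ℝ} (hf : Continuous fun p : ℝ × ℝ => f p.1 p.2)
    (hg : Continuous fun p : ℝ × ℝ => g p.1 p.2) (a b c d : ℝ) :
    ∫ u in a..b, ∫ v in c..d, (f u v + g u v) =
      (∫ u in a..b, ∫ v in c..d, f u v) + ∫ u in a..b, ∫ v in c..d, g u v := by
  rw [← intervalIntegral.integral_add
    (intervalIntegral.continuous_parametric_intervalIntegral_of_continuous' hf c d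
      |>.intervalIntegrable _ _)
    (intervalIntegral.continuous_parametric_intervalIntegral_of_continuous' hg c d
      |>.intervalIntegrable _ _)]
  congr 1 with u
  exact intervalIntegral.integral_add
    ((hf.comp (Continuous.prodMk_right u)).intervalIntegrable _ _)
    ((hg.comp (Continuous.prodMk_right u)).intervalIntegrable _ _)

theorem integral_integral_mul (f g : ℝ → ℝ) (a b c d : ℝ) :
    ∫ u in a..b, ∫ v in c..d, f u * g v = (∫ u in a..b, f u) * ∫ v in c..d, g v := by
  simp only [intervalIntegral.integral_const_mul, intervalIntegral.integral_mul_const]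

/-- The cosine Fourier coefficients of `D_k(cos u, cos v)`, before normalization. -/
noncomputable def chebyshevDividedDifferenceCoeff (k : ℕ) (a b : ℤ) : ℝ :=
  ∫ u in (-π)..π, ∫ v in (-π)..π,
    chebyshevDividedDifference k (Real.cos u) (Real.cos v) * Real.cos (a * u) * Real.cos (b * v)

theorem chebyshevDividedDifferenceCoeff_add_two (k : ℕ) (a b : ℤ) :
    chebyshevDividedDifferenceCoeff (k + 2) a b =
      chebyshevDividedDifferenceCoeff (k + 1) (a + 1) b
        + chebyshevDividedDifferenceCoeff (k + 1) (a - 1) b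
        - chebyshevDividedDifferenceCoeff k a b
        + if a = 0 ∧ |b| = (k : ℤ) + 1 then 4 * π ^ 2 else 0 := by
  have hc : ∀ j : ℕ, Continuous fun p : ℝ × ℝ =>
      chebyshevDividedDifference j (Real.cos p.1) (Real.cos p.2) := fun j =>
    (continuous_chebyshevDividedDifference j).comp (by fun_prop :
      Continuous fun p : ℝ × ℝ => (Real.cos p.1, Real.cos p.2))
  have hc₀ := hc k
  have hc₁ := hc (k + 1)
  have key : ∀ u v : ℝ,
      chebyshevDividedDifference (k + 2) (Real.cos u) (Real.cos v)
          * Real.cos (a * u) * Real.cos (b * v)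
        + chebyshevDividedDifference k (Real.cos u) (Real.cos v)
          * Real.cos (a * u) * Real.cos (b * v) =
      (chebyshevDividedDifference (k + 1) (Real.cos u) (Real.cos v)
          * Real.cos ((a + 1 : ℤ) * u) * Real.cos (b * v)
        + chebyshevDividedDifference (k + 1) (Real.cos u) (Real.cos v)
          * Real.cos ((a - 1 : ℤ) * u) * Real.cos (b * v))
        + (2 * Real.cos (a * u)) * (Real.cos (((k : ℤ) + 1 : ℤ) * v) * Real.cos (b * v)) := by
    intro u v
    simp only [chebyshevDividedDifference, Polynomial.Chebyshev.T_real_cos]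
    push_cast
    rw [add_mul (a : ℝ), sub_mul (a : ℝ), one_mul, Real.cos_add, Real.cos_sub]
    ring
  have hint := congrArg (fun F : ℝ → ℝ → ℝ => ∫ u in (-π)..π, ∫ v in (-π)..π, F u v)
    (funext₂ key)
  have hc₂ := hc (k + 2)
  beta_reduce at hint
  rw [integral_integral_add (by fun_prop) (by fun_prop),
    integral_integral_add (by fun_prop) (by fun_prop),
    integral_integral_add (by fun_prop) (by fun_prop), integral_integral_mul,
    intervalIntegral.integral_const_mul, integral_cos_int_mul,
    integral_cos_int_mul_mul_cos_int_mul] at hint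
  have hend : (2 * if a = 0 then 2 * π else 0) *
      ((if (k : ℤ) + 1 + b = 0 then π else 0) + if (k : ℤ) + 1 - b = 0 then π else 0) =
      if a = 0 ∧ |b| = (k : ℤ) + 1 then 4 * π ^ 2 else 0 := by
    simp only [Int.abs_eq_natAbs]
    split_ifs <;> first | omega | ring
  rw [hend] at hint
  simp only [chebyshevDividedDifferenceCoeff]
  linarith

set_option maxHeartbeats 1600000 in
theorem chebyshevDividedDifferenceCoeff_eq (k : ℕ) (a b : ℤ) :
    chebyshevDividedDifferenceCoeff k a b =
      if 0 < (k : ℤ) - |a| - |b| ∧ ((k : ℤ) - |a| - |b|) % 2 = 1 then 4 * π ^ 2 else 0 := by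
  induction k using Nat.twoStepInduction generalizing a b with
  | zero =>
    rw [if_neg (by simp only [Int.abs_eq_natAbs]; omega)]
    simp [chebyshevDividedDifferenceCoeff, chebyshevDividedDifference]
  | one =>
    simp only [chebyshevDividedDifferenceCoeff, chebyshevDividedDifference, one_mul]
    rw [integral_integral_mul (fun u => Real.cos (a * u)) (fun v => Real.cos (b * v)),
      integral_cos_int_mul, integral_cos_int_mul]
    simp only [Int.abs_eq_natAbs]
    split_ifs <;> first | omega | ring
  | more k ih₀ ih₁ =>
    rw [chebyshevDividedDifferenceCoeff_add_two, ih₀, ih₁, ih₁]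
    push_cast
    simp only [Int.abs_eq_natAbs]
    split_ifs <;> first | omega | ring

/-- For all integers `k ≥ 0` and `0 ≤ α ≤ β`,
`(1/(4π²))·∫∫ D_k(cos u, cos v)·cos(αu)·cos(βv) du dv` equals `1` if `k − α − β` is a
positive odd integer, and `0` otherwise, where `D_k` is the two-variable continuous
function determined by `D_k(x,y)·(x − y) = T_k(x) − T_k(y)`. -/
theorem stmt_12 (k α β : ℕ) (hαβ : α ≤ β) (D : ℝ → ℝ → ℝ)
    (hDcont : Continuous fun p : ℝ × ℝ => D p.1 p.2)
    (hD : ∀ x y : ℝ, D x y * (x - y) =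
      (Polynomial.Chebyshev.T ℝ (k : ℤ)).eval x - (Polynomial.Chebyshev.T ℝ (k : ℤ)).eval y) :
    (1 / (4 * π ^ 2)) *
        ∫ u in (-π)..π, ∫ v in (-π)..π,
          D (Real.cos u) (Real.cos v) * Real.cos (α * u) * Real.cos (β * v)
      = if 0 < (k : ℤ) - α - β ∧ Odd ((k : ℤ) - α - β) then 1 else 0 := by
  have h := chebyshevDividedDifferenceCoeff_eq k α β
  simp only [chebyshevDividedDifferenceCoeff, Int.cast_natCast, Nat.abs_cast] at h
  rw [eq_chebyshevDividedDifference hDcont hD, h]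
  simp only [Int.odd_iff]
  split_ifs
  · field_simp
  · simp
end

section
/- For every θ with 0 < θ ≤ π, ∫_{−θ}^{θ} √(cos μ − cos θ)·cos(μ/2) dμ = √2·π·sin²(θ/2). -/
open Real intervalIntegral

/-- For every `θ` with `0 < θ ≤ π`,
`∫_{−θ}^{θ} √(cos μ − cos θ)·cos(μ/2) dμ = √2·π·sin²(θ/2)`. -/
theorem stmt_13 (θ : ℝ) (hθ0 : 0 < θ) (hθπ : θ ≤ π) :
    ∫ μ in (-θ)..θ, Real.sqrt (Real.cos μ - Real.cos θ) * Real.cos (μ / 2)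
      = Real.sqrt 2 * π * (Real.sin (θ / 2)) ^ 2 := by
  have hs : 0 < sin (θ / 2) := sin_pos_of_pos_of_lt_pi (by linarith) (by linarith)
  set s := sin (θ / 2) with hs_def
  have cos_eq (x : ℝ) : cos x = 1 - 2 * sin (x / 2) ^ 2 := by
    have h := cos_two_mul (x / 2)
    rw [mul_div_cancel₀ x two_ne_zero] at h
    linarith [sin_sq_add_cos_sq (x / 2)]
  have hsqrt (μ : ℝ) : √(cos μ - cos θ) = √2 * s * √(1 - (sin (μ / 2) / s) ^ 2) := by
    have h : cos μ - cos θ = 2 * s ^ 2 * (1 - (sin (μ / 2) / s) ^ 2) := by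
      rw [cos_eq μ, cos_eq θ, ← hs_def]
      field_simp
      ring
    rw [h, sqrt_mul (by positivity), sqrt_mul zero_le_two, sqrt_sq hs.le]
  have hderiv (μ : ℝ) : HasDerivAt (fun x => sin (x / 2) / s) (cos (μ / 2) * (1 / 2) / s) μ :=
    (((hasDerivAt_id μ).div_const 2).sin).div_const s
  have hsubst := integral_comp_mul_deriv (a := -θ) (b := θ) (fun μ _ => hderiv μ)
    (by fun_prop) (g := fun x => √(1 - x ^ 2)) (by fun_prop)
  have hneg : sin (-θ / 2) / s = -1 := by
    rw [neg_div, sin_neg, ← hs_def, neg_div, div_self hs.ne']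
  simp only [hneg, ← hs_def, div_self hs.ne', integral_sqrt_one_sub_sq] at hsubst
  calc ∫ μ in (-θ)..θ, √(cos μ - cos θ) * cos (μ / 2)
      = ∫ μ in (-θ)..θ, (2 * √2 * s ^ 2) *
          (((fun x => √(1 - x ^ 2)) ∘ fun x => sin (x / 2) / s) μ *
            (cos (μ / 2) * (1 / 2) / s)) := by
        refine integral_congr fun μ _ => ?_
        simp only [hsqrt, Function.comp_apply]
        field_simp
    _ = √2 * π * s ^ 2 := by
        rw [integral_const_mul, hsubst]
        ring
end

section
/- For all real a > 0 and real z with |z| > a, ∫_{−a}^{a} dt/((z − t)·√(a² − t²)) = π·sign(z)/√(z² − a²). -/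
open Real

theorem hasDerivAt_arcsin_moebius {a z t : ℝ} (ha : 0 < a) (hz : a < z)
    (ht : t ∈ Set.Ioo (-a) a) :
    HasDerivAt (fun t => arcsin ((z * t - a ^ 2) / (a * (z - t))) / √(z ^ 2 - a ^ 2))
      (1 / ((z - t) * √(a ^ 2 - t ^ 2))) t := by
  obtain ⟨ht₁, ht₂⟩ := ht
  have hzt : 0 < z - t := by linarith
  have hD : 0 < z ^ 2 - a ^ 2 := by nlinarith
  have hE : 0 < a ^ 2 - t ^ 2 := by nlinarith
  have hu : 1 - ((z * t - a ^ 2) / (a * (z - t))) ^ 2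
      = (z ^ 2 - a ^ 2) * (a ^ 2 - t ^ 2) / (a * (z - t)) ^ 2 := by
    field_simp
    ring
  have hpos : 0 < 1 - ((z * t - a ^ 2) / (a * (z - t))) ^ 2 := by
    rw [hu]
    positivity
  have hder : HasDerivAt (fun t => (z * t - a ^ 2) / (a * (z - t)))
      ((z ^ 2 - a ^ 2) / (a * (z - t) ^ 2)) t := by
    have h := (((hasDerivAt_id t).const_mul z).sub_const (a ^ 2)).div
      (((hasDerivAt_id t).const_sub z).const_mul a) (by simp only [id]; positivity)
    refine h.congr_deriv ?_
    simp only [id]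
    field_simp
    ring
  have h := ((hasDerivAt_arcsin (fun h => by rw [h] at hpos; norm_num at hpos)
    (fun h => by rw [h] at hpos; norm_num at hpos)).comp t hder).div_const √(z ^ 2 - a ^ 2)
  refine h.congr_deriv ?_
  rw [hu, sqrt_div (by positivity), sqrt_mul hD.le, sqrt_sq (by positivity)]
  have hs := sqrt_pos.2 hD
  have hr := sqrt_pos.2 hE
  field_simp
  rw [sq_sqrt hD.le]

theorem integral_one_div_sub_mul_sqrt_of_lt {a z : ℝ} (ha : 0 < a) (hz : a < z) :
    ∫ t in (-a)..a, 1 / ((z - t) * √(a ^ 2 - t ^ 2)) = π / √(z ^ 2 - a ^ 2) := by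
  have hle : -a ≤ a := by linarith
  have hcont : ContinuousOn
      (fun t => arcsin ((z * t - a ^ 2) / (a * (z - t))) / √(z ^ 2 - a ^ 2))
      (Set.Icc (-a) a) := by
    refine ContinuousOn.div_const (continuous_arcsin.comp_continuousOn ?_) _
    refine ContinuousOn.div (by fun_prop) (by fun_prop) fun t ht => ?_
    have : 0 < z - t := by linarith [ht.2]
    positivity
  have hderiv := fun t => hasDerivAt_arcsin_moebius (t := t) ha hz
  have hint : IntervalIntegrable (fun t => 1 / ((z - t) * √(a ^ 2 - t ^ 2)))
      MeasureTheory.volume (-a) a := by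
    rw [intervalIntegrable_iff_integrableOn_Ioc_of_le hle]
    refine intervalIntegral.integrableOn_deriv_of_nonneg hcont hderiv fun t ht => ?_
    have : 0 < z - t := by linarith [ht.2]
    positivity
  rw [intervalIntegral.integral_eq_sub_of_hasDerivAt_of_le hle hcont hderiv hint]
  have h₁ : (z * a - a ^ 2) / (a * (z - a)) = 1 := by
    have : z - a ≠ 0 := by linarith
    field_simp
  have h₂ : (z * -a - a ^ 2) / (a * (z - -a)) = -1 := by
    have : z - -a ≠ 0 := by linarith
    field_simp
    ring
  simp only [h₁, h₂, arcsin_one, arcsin_neg]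
  ring

/-- For all real `a > 0` and real `z` with `|z| > a`,
`∫_{−a}^{a} dt/((z − t)·√(a² − t²)) = π·sign(z)/√(z² − a²)`. -/
theorem stmt_15 (a z : ℝ) (ha : 0 < a) (hz : a < |z|) :
    ∫ t in (-a)..a, 1 / ((z - t) * Real.sqrt (a ^ 2 - t ^ 2))
      = π * Real.sign z / Real.sqrt (z ^ 2 - a ^ 2) := by
  rcases lt_abs.1 hz with h | h
  · rw [integral_one_div_sub_mul_sqrt_of_lt ha h, Real.sign_of_pos (ha.trans h), mul_one]
  · have key := integral_one_div_sub_mul_sqrt_of_lt ha h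
    rw [neg_sq] at key
    have hneg := intervalIntegral.integral_comp_neg (a := -a) (b := a)
      fun t => 1 / ((z - t) * √(a ^ 2 - t ^ 2))
    rw [neg_neg] at hneg
    rw [← hneg, Real.sign_of_neg (by linarith), mul_neg_one, neg_div, ← key,
      ← intervalIntegral.integral_neg]
    refine intervalIntegral.integral_congr fun t _ => ?_
    simp only [neg_sq]
    rw [show z - -t = -(-z - t) by ring, neg_mul, div_neg]
end

section
/- For every θ with 0 < θ < π and every λ with θ < |λ| ≤ π, ∫_{−θ}^{θ} cot((λ − μ)/2)·cos(μ/2)/√(cos μ − cos θ) dμ = 2π·sign(λ)·cos(λ/2)/√(cos θ − cos λ). -/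
open Real

theorem hasDerivAt_arcsin_div {a s : ℝ} (ha : 0 < a) (hs : s ^ 2 < a ^ 2) :
    HasDerivAt (fun s => arcsin (s / a)) (1 / √(a ^ 2 - s ^ 2)) s := by
  obtain ⟨h1, h2⟩ := abs_lt.1 (abs_lt_of_sq_lt_sq hs ha.le)
  have hm : s / a ≠ -1 := by rw [ne_eq, div_eq_iff ha.ne']; linarith
  have hp : s / a ≠ 1 := by rw [ne_eq, div_eq_iff ha.ne']; linarith
  refine ((hasDerivAt_arcsin hm hp).comp s ((hasDerivAt_id s).div_const a)).congr_deriv ?_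
  have hsq : √(1 - (s / a) ^ 2) = √(a ^ 2 - s ^ 2) / a := by
    rw [show 1 - (s / a) ^ 2 = (a ^ 2 - s ^ 2) / a ^ 2 by field_simp, sqrt_div' _ (sq_nonneg a),
      sqrt_sq ha.le]
  have : 0 < √(a ^ 2 - s ^ 2) := sqrt_pos.2 (by linarith)
  rw [hsq]
  field_simp

theorem hasDerivAt_arcsin_mul_div_sqrt {a b s : ℝ} (ha : 0 < a) (hab : a < b)
    (hs : s ^ 2 < a ^ 2) :
    HasDerivAt (fun s => arcsin (s * √(b ^ 2 - a ^ 2) / (a * √(b ^ 2 - s ^ 2))))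
      (√(b ^ 2 - a ^ 2) * b / ((b ^ 2 - s ^ 2) * √(a ^ 2 - s ^ 2))) s := by
  have hb : 0 < b := ha.trans hab
  have hab2 : a ^ 2 < b ^ 2 := by gcongr
  have hR0 : 0 < b ^ 2 - s ^ 2 := by linarith
  have hk : 0 < √(b ^ 2 - a ^ 2) := sqrt_pos.2 (by linarith)
  have hR : 0 < √(b ^ 2 - s ^ 2) := sqrt_pos.2 hR0
  have hQ : 0 < √(a ^ 2 - s ^ 2) := sqrt_pos.2 (by linarith)
  have hk2 : √(b ^ 2 - a ^ 2) ^ 2 = b ^ 2 - a ^ 2 := sq_sqrt (by linarith)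
  have hR2 : √(b ^ 2 - s ^ 2) ^ 2 = b ^ 2 - s ^ 2 := sq_sqrt hR0.le
  have hQ2 : √(a ^ 2 - s ^ 2) ^ 2 = a ^ 2 - s ^ 2 := sq_sqrt (by linarith)
  have hsqrt : HasDerivAt (fun s => √(b ^ 2 - s ^ 2)) (-s / √(b ^ 2 - s ^ 2)) s := by
    refine (((hasDerivAt_pow 2 s).const_sub (b ^ 2)).sqrt hR0.ne').congr_deriv ?_
    field_simp
    norm_num
  have hu := ((hasDerivAt_id s).mul_const √(b ^ 2 - a ^ 2)).div (hsqrt.const_mul a)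
    (by positivity)
  simp only [id] at hu
  have hcos : 1 - (s * √(b ^ 2 - a ^ 2) / (a * √(b ^ 2 - s ^ 2))) ^ 2
      = (b * √(a ^ 2 - s ^ 2) / (a * √(b ^ 2 - s ^ 2))) ^ 2 := by
    simp only [div_pow, mul_pow, hk2, hR2, hQ2]
    field_simp
    ring
  have hpos : 0 < (b * √(a ^ 2 - s ^ 2) / (a * √(b ^ 2 - s ^ 2))) ^ 2 := by positivity
  have hm : s * √(b ^ 2 - a ^ 2) / (a * √(b ^ 2 - s ^ 2)) ≠ -1 := by
    intro h; rw [h] at hcos; linarith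
  have hp : s * √(b ^ 2 - a ^ 2) / (a * √(b ^ 2 - s ^ 2)) ≠ 1 := by
    intro h; rw [h] at hcos; linarith
  refine ((hasDerivAt_arcsin hm hp).comp s hu).congr_deriv ?_
  rw [hcos, sqrt_sq (by positivity)]
  generalize √(b ^ 2 - s ^ 2) = R at *
  rw [← hR2]
  field_simp
  rw [hR2]
  ring

theorem cos_sub_cos_eq_sin_half_sq (x y : ℝ) :
    cos x - cos y = 2 * (sin (y / 2) ^ 2 - sin (x / 2) ^ 2) := by
  rw [sin_sq_eq_half_sub, sin_sq_eq_half_sub, mul_div_cancel₀ x two_ne_zero,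
    mul_div_cancel₀ y two_ne_zero]
  ring

theorem cot_sub_add_cot_add {x y : ℝ} (h₁ : sin (x - y) ≠ 0) (h₂ : sin (x + y) ≠ 0) :
    cot (x - y) + cot (x + y) = sin (2 * x) / (sin x ^ 2 - sin y ^ 2) := by
  have h : sin (x - y) * sin (x + y) = sin x ^ 2 - sin y ^ 2 := by
    rw [sin_sub, sin_add]
    linear_combination (-sin y ^ 2) * sin_sq_add_cos_sq x + sin x ^ 2 * sin_sq_add_cos_sq y
  rw [cot_eq_cos_div_sin, cot_eq_cos_div_sin, div_add_div _ _ h₁ h₂, h,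
    show 2 * x = (x - y) + (x + y) by ring, sin_add (x - y)]
  ring

theorem sin_half_sq_lt_sin_half_sq {x y : ℝ} (hxy : |x| < y) (hy : y ≤ π) :
    sin (x / 2) ^ 2 < sin (y / 2) ^ 2 := by
  have h := cos_lt_cos_of_nonneg_of_le_pi (abs_nonneg x) hy hxy
  rw [cos_abs] at h
  linarith [cos_sub_cos_eq_sin_half_sq x y]

theorem hasDerivAt_sin_half (x : ℝ) : HasDerivAt (fun x => sin (x / 2)) (cos (x / 2) / 2) x :=
  ((hasDerivAt_id x).div_const 2).sin.congr_deriv (by simp [div_eq_mul_inv])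

theorem intervalIntegrable_cos_half_div_sqrt {θ : ℝ} (hθ0 : 0 < θ) (hθπ : θ < π) :
    IntervalIntegrable (fun μ => cos (μ / 2) / √(cos μ - cos θ)) MeasureTheory.volume (-θ) θ := by
  have ha : 0 < sin (θ / 2) := sin_pos_of_pos_of_lt_pi (by linarith) (by linarith)
  have hle : -θ ≤ θ := by linarith
  apply intervalIntegral.intervalIntegrable_deriv_of_nonneg
    (g := fun μ => √2 * arcsin (sin (μ / 2) / sin (θ / 2)))
  · fun_prop
  · intro μ hμ
    rw [min_eq_left hle, max_eq_right hle] at hμ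
    have hs := sin_half_sq_lt_sin_half_sq (abs_lt.2 hμ) hθπ.le
    refine (((hasDerivAt_arcsin_div ha hs).comp μ (hasDerivAt_sin_half μ)).const_mul
      √2).congr_deriv ?_
    have : 0 < √(sin (θ / 2) ^ 2 - sin (μ / 2) ^ 2) := sqrt_pos.2 (by linarith)
    rw [cos_sub_cos_eq_sin_half_sq, sqrt_mul zero_le_two]
    field_simp
    norm_num
  · intro μ hμ
    rw [min_eq_left hle, max_eq_right hle] at hμ
    exact div_nonneg (cos_nonneg_of_mem_Icc ⟨by linarith [hμ.1], by linarith [hμ.2]⟩)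
      (sqrt_nonneg _)

theorem sin_half_sub_ne_zero {θ l μ : ℝ} (hθπ : θ < π) (hl1 : θ < |l|) (hl2 : |l| ≤ π)
    (hμ : |μ| ≤ θ) : sin ((l - μ) / 2) ≠ 0 := by
  obtain ⟨h1, h2⟩ := abs_le.1 hμ
  rcases le_total 0 l with hl | hl
  · rw [abs_of_nonneg hl] at hl1 hl2
    exact (sin_pos_of_pos_of_lt_pi (by linarith) (by linarith)).ne'
  · rw [abs_of_nonpos hl] at hl1 hl2
    exact (sin_neg_of_neg_of_neg_pi_lt (by linarith) (by linarith)).ne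

theorem intervalIntegrable_cot_mul {θ l : ℝ} (hθ0 : 0 < θ) (hθπ : θ < π)
    (hl1 : θ < |l|) (hl2 : |l| ≤ π) :
    IntervalIntegrable (fun μ => cot ((l - μ) / 2) * cos (μ / 2) / √(cos μ - cos θ))
      MeasureTheory.volume (-θ) θ := by
  simp only [mul_div_assoc]
  refine (intervalIntegrable_cos_half_div_sqrt hθ0 hθπ).continuousOn_mul ?_
  simp only [cot_eq_cos_div_sin]
  refine ContinuousOn.div (by fun_prop) (by fun_prop) fun μ hμ => ?_
  rw [Set.uIcc_of_le (by linarith)] at hμ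
  exact sin_half_sub_ne_zero hθπ hl1 hl2 (abs_le.2 hμ)

theorem integral_cos_half_div_sq_sub_mul_sqrt {θ b : ℝ} (hθ0 : 0 < θ) (hθπ : θ < π)
    (hb : sin (θ / 2) < b) :
    ∫ μ in (-θ)..θ, cos (μ / 2) / ((b ^ 2 - sin (μ / 2) ^ 2) * √(cos μ - cos θ))
      = √2 * π / (b * √(b ^ 2 - sin (θ / 2) ^ 2)) := by
  have ha : 0 < sin (θ / 2) := sin_pos_of_pos_of_lt_pi (by linarith) (by linarith)
  have hle : -θ ≤ θ := by linarith
  have hb0 : 0 < b := ha.trans hb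
  have hab : sin (θ / 2) ^ 2 < b ^ 2 := by gcongr
  have hk : 0 < √(b ^ 2 - sin (θ / 2) ^ 2) := sqrt_pos.2 (by linarith)
  have hR : ∀ μ ∈ Set.Icc (-θ) θ, 0 < b ^ 2 - sin (μ / 2) ^ 2 := by
    intro μ hμ
    have : sin (μ / 2) ^ 2 ≤ sin (θ / 2) ^ 2 := by
      rcases (abs_le.2 hμ).lt_or_eq with h | h
      · exact (sin_half_sq_lt_sin_half_sq h hθπ.le).le
      · rcases abs_choice μ with h' | h' <;> rw [← h, h']
        simp [neg_div]
    linarith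
  rw [intervalIntegral.integral_eq_sub_of_hasDerivAt_of_le hle
    (f := fun μ => √2 / (b * √(b ^ 2 - sin (θ / 2) ^ 2)) *
      arcsin (sin (μ / 2) * √(b ^ 2 - sin (θ / 2) ^ 2) /
        (sin (θ / 2) * √(b ^ 2 - sin (μ / 2) ^ 2))))]
  · have h1 : sin (θ / 2) * √(b ^ 2 - sin (θ / 2) ^ 2) /
        (sin (θ / 2) * √(b ^ 2 - sin (θ / 2) ^ 2)) = 1 := div_self (by positivity)
    simp only [neg_div, sin_neg, neg_sq, neg_mul, h1, arcsin_neg, arcsin_one]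
    ring
  · refine continuousOn_const.mul (continuous_arcsin.comp_continuousOn ?_)
    exact ContinuousOn.div (by fun_prop) (by fun_prop) fun μ hμ =>
      (mul_pos ha (sqrt_pos.2 (hR μ hμ))).ne'
  · intro μ hμ
    have hs := sin_half_sq_lt_sin_half_sq (abs_lt.2 hμ) hθπ.le
    refine (((hasDerivAt_arcsin_mul_div_sqrt ha hb hs).comp μ
      (hasDerivAt_sin_half μ)).const_mul _).congr_deriv ?_
    have hQ : 0 < √(sin (θ / 2) ^ 2 - sin (μ / 2) ^ 2) := sqrt_pos.2 (by linarith)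
    have hR' := hR μ ⟨hμ.1.le, hμ.2.le⟩
    rw [cos_sub_cos_eq_sin_half_sq, sqrt_mul zero_le_two]
    field_simp
    norm_num
  · have := (intervalIntegrable_cos_half_div_sqrt hθ0 hθπ).continuousOn_mul
      (g := fun μ => 1 / (b ^ 2 - sin (μ / 2) ^ 2)) (by
        rw [Set.uIcc_of_le hle]
        exact ContinuousOn.div (by fun_prop) (by fun_prop) fun μ hμ => (hR μ hμ).ne')
    simpa only [div_mul_div_comm, one_mul] using this

/-- For every `θ` with `0 < θ < π` and every `λ` with `θ < |λ| ≤ π`,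
`∫_{−θ}^{θ} cot((λ − μ)/2)·cos(μ/2)/√(cos μ − cos θ) dμ
  = 2π·sign(λ)·cos(λ/2)/√(cos θ − cos λ)`. -/
theorem stmt_16 (θ l : ℝ) (hθ0 : 0 < θ) (hθπ : θ < π)
    (hl1 : θ < |l|) (hl2 : |l| ≤ π) :
    ∫ μ in (-θ)..θ,
        Real.cot ((l - μ) / 2) * Real.cos (μ / 2) / Real.sqrt (Real.cos μ - Real.cos θ)
      = 2 * π * Real.sign l * Real.cos (l / 2) / Real.sqrt (Real.cos θ - Real.cos l) := by
  have hle : -θ ≤ θ := by linarith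
  have hlt : sin (θ / 2) < sin (|l| / 2) :=
    sin_lt_sin_of_lt_of_le_pi_div_two (by linarith) (by linarith) (by linarith)
  have ha : 0 < sin (θ / 2) := sin_pos_of_pos_of_lt_pi (by linarith) (by linarith)
  have hsign : sin (l / 2) = sign l * sin (|l| / 2) := by
    rcases lt_trichotomy l 0 with h | h | h
    · simp [sign_of_neg h, abs_of_neg h, neg_div]
    · simp [h]
    · simp [sign_of_pos h, abs_of_pos h]
  have hsq : sin (|l| / 2) ^ 2 = sin (l / 2) ^ 2 := by
    rcases abs_choice l with h | h <;> simp [h, neg_div]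
  have hpos := intervalIntegrable_cot_mul hθ0 hθπ hl1 hl2
  have hneg : IntervalIntegrable
      (fun μ => cot ((l + μ) / 2) * cos (μ / 2) / √(cos μ - cos θ))
      MeasureTheory.volume (-θ) θ := by
    simpa [neg_div] using ((IntervalIntegrable.iff_comp_neg (by simp)).1 hpos).symm
  have hrefl : ∫ μ in (-θ)..θ, cot ((l + μ) / 2) * cos (μ / 2) / √(cos μ - cos θ)
      = ∫ μ in (-θ)..θ, cot ((l - μ) / 2) * cos (μ / 2) / √(cos μ - cos θ) := by
    simpa [neg_div] using intervalIntegral.integral_comp_neg (a := -θ) (b := θ)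
      (fun μ => cot ((l - μ) / 2) * cos (μ / 2) / √(cos μ - cos θ))
  have hsum := intervalIntegral.integral_add hpos hneg
  rw [hrefl, intervalIntegral.integral_congr (g := fun μ => sin l *
    (cos (μ / 2) / ((sin (|l| / 2) ^ 2 - sin (μ / 2) ^ 2) * √(cos μ - cos θ)))),
    intervalIntegral.integral_const_mul,
    integral_cos_half_div_sq_sub_mul_sqrt hθ0 hθπ hlt] at hsum
  · have hk : 0 < √(sin (|l| / 2) ^ 2 - sin (θ / 2) ^ 2) := by
      apply sqrt_pos.2
      have : sin (θ / 2) ^ 2 < sin (|l| / 2) ^ 2 := by gcongr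
      linarith
    have hB : 0 < sin (|l| / 2) := ha.trans hlt
    have hl : sin l = 2 * (sign l * sin (|l| / 2)) * cos (l / 2) := by
      rw [← hsign, ← sin_two_mul, mul_div_cancel₀ l two_ne_zero]
    rw [cos_sub_cos_eq_sin_half_sq, ← hsq, sqrt_mul zero_le_two]
    rw [hl] at hsum
    field_simp at hsum ⊢
    linear_combination (-(√2 / 2)) * hsum
      + sign l * cos (l / 2) * π * sq_sqrt (zero_le_two (α := ℝ))
  · intro μ hμ
    rw [Set.uIcc_of_le hle] at hμ
    have h1 := sin_half_sub_ne_zero hθπ hl1 hl2 (abs_le.2 hμ)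
    have h2 := sin_half_sub_ne_zero (μ := -μ) hθπ hl1 hl2 (by rw [abs_neg]; exact abs_le.2 hμ)
    rw [sub_neg_eq_add] at h2
    rw [sub_div] at h1
    rw [add_div] at h2
    have h := cot_sub_add_cot_add h1 h2
    rw [mul_div_cancel₀ l two_ne_zero] at h
    beta_reduce
    rw [sub_div, add_div l, ← add_div _ _ √(cos μ - cos θ), ← add_mul, h, hsq,
      div_mul_eq_mul_div, div_div, mul_div_assoc]
end

section
/- For every θ with 0 < θ < π, ∫_{−θ}^{θ} cos(μ/2)·cos(2μ)/√(sin²(θ/2) − sin²(μ/2)) dμ = 2π·(3·sin⁴(θ/2) − 4·sin²(θ/2) + 1). -/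
open Real

/-- The derivative of `μ ↦ arcsin (sin (μ / 2) / a)` wherever `sin² (μ / 2) < a²`. -/
lemma hasDerivAt_arcsin_sin_half_div {a μ : ℝ} (ha : 0 < a) (h : sin (μ / 2) ^ 2 < a ^ 2) :
    HasDerivAt (fun x => arcsin (sin (x / 2) / a))
      (cos (μ / 2) / 2 / √(a ^ 2 - sin (μ / 2) ^ 2)) μ := by
  have hs : HasDerivAt (fun x => sin (x / 2)) (cos (μ / 2) * (1 / 2)) μ :=
    ((hasDerivAt_id μ).div_const 2).sin
  have hlt := abs_lt.1 (abs_lt_of_sq_lt_sq h ha.le)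
  have h1 : sin (μ / 2) / a ≠ -1 := by
    intro h
    rw [div_eq_iff ha.ne'] at h
    linarith
  have h2 : sin (μ / 2) / a ≠ 1 := by
    intro h
    rw [div_eq_iff ha.ne'] at h
    linarith
  have hR : √(1 - (sin (μ / 2) / a) ^ 2) = √(a ^ 2 - sin (μ / 2) ^ 2) / a := by
    rw [← Real.sqrt_sq ha.le, ← Real.sqrt_div' _ (sq_nonneg a), Real.sqrt_sq ha.le]
    congr 1
    field_simp
  have hpos : 0 < √(a ^ 2 - sin (μ / 2) ^ 2) := Real.sqrt_pos.2 (by linarith)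
  refine ((hasDerivAt_arcsin h1 h2).comp μ (hs.div_const a)).congr_deriv ?_
  rw [hR]
  field_simp

/-- An antiderivative of `cos (μ / 2) * cos (2 * μ) / √(a² - sin² (μ / 2))`. -/
lemma hasDerivAt_antideriv_cos_half_mul_cos_two_mul {a μ : ℝ} (ha : 0 < a)
    (h : sin (μ / 2) ^ 2 < a ^ 2) :
    HasDerivAt (fun x => 2 * ((3 * a ^ 4 - 4 * a ^ 2 + 1) * arcsin (sin (x / 2) / a) +
        ((4 - 3 * a ^ 2) * sin (x / 2) - 2 * sin (x / 2) ^ 3) * √(a ^ 2 - sin (x / 2) ^ 2)))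
      (cos (μ / 2) * cos (2 * μ) / √(a ^ 2 - sin (μ / 2) ^ 2)) μ := by
  have hs : HasDerivAt (fun x => sin (x / 2)) (cos (μ / 2) * (1 / 2)) μ :=
    ((hasDerivAt_id μ).div_const 2).sin
  have hpos : 0 < √(a ^ 2 - sin (μ / 2) ^ 2) := Real.sqrt_pos.2 (by linarith)
  have hsq : √(a ^ 2 - sin (μ / 2) ^ 2) ^ 2 = a ^ 2 - sin (μ / 2) ^ 2 :=
    Real.sq_sqrt (by linarith)
  have hsqrt := ((hs.pow 2).const_sub (a ^ 2)).sqrt (by simp only [Pi.pow_apply]; linarith)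
  have hcos : cos (2 * μ) = 1 - 8 * sin (μ / 2) ^ 2 + 8 * sin (μ / 2) ^ 4 := by
    have : cos μ = 1 - 2 * sin (μ / 2) ^ 2 := by
      rw [← Real.cos_sq_add_sin_sq (μ / 2)]
      conv_lhs => rw [show μ = 2 * (μ / 2) by ring, Real.cos_two_mul']
      ring
    rw [Real.cos_two_mul, this]
    ring
  refine ((((hasDerivAt_arcsin_sin_half_div ha h).const_mul (3 * a ^ 4 - 4 * a ^ 2 + 1)).add
    (((hs.const_mul (4 - 3 * a ^ 2)).sub ((hs.pow 3).const_mul 2)).mul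
      hsqrt)).const_mul 2).congr_deriv ?_
  simp only [Pi.pow_apply, Pi.sub_apply, hcos]
  generalize √(a ^ 2 - sin (μ / 2) ^ 2) = R at *
  generalize sin (μ / 2) = s at *
  generalize cos (μ / 2) = c at *
  field_simp
  rw [hsq]
  push_cast
  ring

theorem stmt_19 (θ : ℝ) (hθ0 : 0 < θ) (hθπ : θ < π) :
    ∫ μ in (-θ)..θ,
        Real.cos (μ / 2) * Real.cos (2 * μ) /
          Real.sqrt ((Real.sin (θ / 2)) ^ 2 - (Real.sin (μ / 2)) ^ 2)
      = 2 * π * (3 * (Real.sin (θ / 2)) ^ 4 - 4 * (Real.sin (θ / 2)) ^ 2 + 1) := by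
  have ha : 0 < sin (θ / 2) := sin_pos_of_pos_of_lt_pi (by linarith) (by linarith)
  have hlt : ∀ μ ∈ Set.Ioo (-θ) θ, sin (μ / 2) ^ 2 < sin (θ / 2) ^ 2 := by
    intro μ hμ
    have h1 : sin (μ / 2) < sin (θ / 2) :=
      sin_lt_sin_of_lt_of_le_pi_div_two (by linarith [hμ.1]) (by linarith) (by linarith [hμ.2])
    have h2 : sin (-(θ / 2)) < sin (μ / 2) :=
      sin_lt_sin_of_lt_of_le_pi_div_two (by linarith) (by linarith [hμ.2]) (by linarith [hμ.1])
    rw [sin_neg] at h2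
    exact sq_lt_sq' h2 h1
  have hle : -θ ≤ θ := by linarith
  have h_arcsin : IntervalIntegrable
      (fun μ => cos (μ / 2) / 2 / √(sin (θ / 2) ^ 2 - sin (μ / 2) ^ 2))
      MeasureTheory.volume (-θ) θ := by
    refine intervalIntegral.intervalIntegrable_deriv_of_nonneg
      (g := fun x => arcsin (sin (x / 2) / sin (θ / 2))) (by fun_prop) ?_ ?_ <;>
      rw [min_eq_left hle, max_eq_right hle] <;> intro μ hμ
    · exact hasDerivAt_arcsin_sin_half_div ha (hlt μ hμ)
    · have := cos_nonneg_of_neg_pi_div_two_le_of_le (x := μ / 2)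
        (by linarith [hμ.1]) (by linarith [hμ.2])
      positivity
  have h_integrable : IntervalIntegrable
      (fun μ => cos (μ / 2) * cos (2 * μ) / √(sin (θ / 2) ^ 2 - sin (μ / 2) ^ 2))
      MeasureTheory.volume (-θ) θ := by
    refine (h_arcsin.mul_continuousOn (g := fun μ => 2 * cos (2 * μ)) (by fun_prop)).congr ?_
    intro μ _
    ring
  rw [intervalIntegral.integral_eq_sub_of_hasDerivAt_of_le hle (by fun_prop)
    (fun μ hμ => hasDerivAt_antideriv_cos_half_mul_cos_two_mul ha (hlt μ hμ)) h_integrable]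
  simp only [neg_div, sin_neg, div_self ha.ne', arcsin_neg, arcsin_one, neg_sq, sub_self,
    sqrt_zero]
  ring
end
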